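/- Let A be an invertible real 2×2 matrix, θ ∈ ℝ with sin(θ/2) ≠ 0, A₁ = R_{-θ/2} A and A₂ = R_{θ/2} A. Then A₁⁻¹ - A₂⁻¹ is invertible and the moiré fundamental matrix is A_M = (A₁⁻¹ - A₂⁻¹)⁻¹ = (1/(2 sin(θ/2))) J A, where J = R_{-π/2}; i.e., the twisted bilayer moiré lattice is the reference lattice rotated by -π/2 and scaled by 1/(2 sin(θ/2)). -/

import Mathlib

open Matrix Real

/-- The rotation matrix `R_φ`. -/
noncomputable def Rot (φ : ℝ) : Matrix (Fin 2) (Fin 2) ℝ :=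
  !![Real.cos φ, -Real.sin φ; Real.sin φ, Real.cos φ]

/-- `J = R_{-π/2}`. -/
def Jm : Matrix (Fin 2) (Fin 2) ℝ := !![0, 1; -1, 0]

theorem Rot_neg_mul_Rot (φ : ℝ) : Rot (-φ) * Rot φ = 1 := by
  have h := Real.sin_sq_add_cos_sq φ
  ext i j
  fin_cases i <;> fin_cases j <;> simp [Rot, Matrix.mul_apply, Fin.sum_univ_two] <;> linarith

theorem Rot_inv (φ : ℝ) : (Rot φ)⁻¹ = Rot (-φ) :=
  Matrix.inv_eq_left_inv (Rot_neg_mul_Rot φ)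

theorem Rot_sub_Rot_neg_mul_Jm (φ : ℝ) :
    (Rot φ - Rot (-φ)) * Jm = (2 * Real.sin φ) • (1 : Matrix (Fin 2) (Fin 2) ℝ) := by
  ext i j
  fin_cases i <;> fin_cases j <;> simp [Rot, Jm, Matrix.mul_apply, Fin.sum_univ_two] <;> ring

/-- For the twisted bilayer `A₁ = R_{-θ/2}A`, `A₂ = R_{θ/2}A` with
`sin(θ/2) ≠ 0`, the matrix `A₁⁻¹ - A₂⁻¹` is invertible and the moiré
fundamental matrix is `A_M = (A₁⁻¹ - A₂⁻¹)⁻¹ = (1/(2 sin(θ/2))) J A`. -/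
theorem twisted_moire_lattice
    (A : Matrix (Fin 2) (Fin 2) ℝ) (hA : IsUnit A.det)
    (θ : ℝ) (hθ : Real.sin (θ / 2) ≠ 0)
    (A₁ A₂ : Matrix (Fin 2) (Fin 2) ℝ)
    (hA₁ : A₁ = Rot (-(θ / 2)) * A) (hA₂ : A₂ = Rot (θ / 2) * A) :
    IsUnit (A₁⁻¹ - A₂⁻¹).det ∧
    (A₁⁻¹ - A₂⁻¹)⁻¹ = (1 / (2 * Real.sin (θ / 2))) • (Jm * A) := by
  have h : (A₁⁻¹ - A₂⁻¹) * ((1 / (2 * Real.sin (θ / 2))) • (Jm * A)) = 1 := by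
    rw [hA₁, hA₂, Matrix.mul_inv_rev, Matrix.mul_inv_rev, Rot_inv, Rot_inv, neg_neg,
      ← Matrix.mul_sub, Matrix.mul_smul, Matrix.mul_assoc, ← Matrix.mul_assoc _ Jm,
      Rot_sub_Rot_neg_mul_Jm, Matrix.smul_mul, Matrix.one_mul, Matrix.mul_smul,
      Matrix.nonsing_inv_mul A hA, smul_smul, one_div_mul_cancel (mul_ne_zero two_ne_zero hθ),
      one_smul]
  exact ⟨Matrix.isUnit_det_of_right_inverse h, Matrix.inv_eq_right_inv h⟩
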